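/- For every fixed integer j ≥ 1, the sequence a_k = |f_j^{(2k−1)}(0)| = (2k+j−1)! · |B_{2k}|/(2k)! indexed by integers k ≥ 1 is logarithmically convex; that is, a_k² ≤ a_{k−1} · a_{k+1} for every integer k ≥ 2. -/

import Mathlib

/-- `G_j(v) = v^j/(1 - e^{-v})` for `v ≠ 0`, `G_1(0) = 1`, and `G_j(0) = 0` for `j > 1`. -/
noncomputable def G (j : ℕ) : ℝ → ℝ := fun v =>
  if v = 0 then (if j = 1 then 1 else 0) else v ^ j / (1 - Real.exp (-v))

theorem iteratedDeriv_pow_mul_zero (m n : ℕ) {f : ℝ → ℝ} (hf : ContDiffAt ℝ n f 0) :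
    iteratedDeriv n (fun v => v ^ m * f v) 0 =
      (n.descFactorial m : ℝ) * iteratedDeriv (n - m) f 0 := by
  rw [iteratedDeriv_fun_mul (by fun_prop) hf]
  rcases le_or_gt m n with h | h
  · rw [Finset.sum_eq_single_of_mem m (Finset.mem_range.2 (by omega))]
    · rw [iteratedDeriv_fun_pow_zero, if_pos rfl, Nat.descFactorial_eq_factorial_mul_choose]
      push_cast
      ring
    · intro i _ hi
      rw [iteratedDeriv_fun_pow_zero, if_neg hi]
      simp
  · rw [Nat.descFactorial_eq_zero_iff_lt.2 h, Finset.sum_eq_zero]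
    · simp
    · intro i hi
      rw [iteratedDeriv_fun_pow_zero, if_neg (by have := Finset.mem_range.1 hi; omega)]
      simp

theorem G_eq_pow_mul_G_one {j : ℕ} (hj : 1 ≤ j) : G j = fun v => v ^ (j - 1) * G 1 v := by
  obtain ⟨m, rfl⟩ := Nat.exists_eq_add_of_le' hj
  funext v
  rcases eq_or_ne v 0 with rfl | hv
  · rcases Nat.eq_zero_or_pos m with rfl | hm
    · simp [G]
    · simp [G, hm.ne']
  · simp only [G, if_neg hv, Nat.add_sub_cancel]
    ring

theorem one_sub_exp_neg_ne_zero {v : ℝ} (hv : v ≠ 0) : 1 - Real.exp (-v) ≠ 0 := by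
  rw [sub_ne_zero, ne_comm, Ne, Real.exp_eq_one_iff]
  simpa using hv

theorem analyticAt_G_one : AnalyticAt ℝ (G 1) 0 := by
  have hd : HasDerivAt (fun v : ℝ => 1 - Real.exp (-v)) 1 0 := by
    simpa using ((hasDerivAt_neg (0 : ℝ)).exp).const_sub 1
  have hG : G 1 = (dslope (fun v : ℝ => 1 - Real.exp (-v)) 0)⁻¹ := by
    funext v
    rcases eq_or_ne v 0 with rfl | hv
    · simp [G, hd.deriv]
    · simp [G, hv, dslope_of_ne, slope_def_field]
  have ha : AnalyticAt ℝ (fun v : ℝ => 1 - Real.exp (-v)) 0 := by fun_prop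
  obtain ⟨p, hp⟩ := ha
  rw [hG]
  refine AnalyticAt.inv ⟨_, hp.has_fpower_series_dslope_fslope⟩ ?_
  simp [hd.deriv]

theorem G_one_mul_exp_sub_one (v : ℝ) : G 1 v * (Real.exp v - 1) = v ^ 1 * Real.exp v := by
  rcases eq_or_ne v 0 with rfl | hv
  · simp
  · have h := one_sub_exp_neg_ne_zero hv
    simp only [G, if_neg hv]
    rw [div_mul_eq_mul_div, div_eq_iff h, mul_assoc, mul_sub (Real.exp v), ← Real.exp_add]
    simp

theorem sum_choose_mul_iteratedDeriv_G_one (n : ℕ) :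
    ∑ i ∈ Finset.range n, (n.choose i : ℝ) * iteratedDeriv i (G 1) 0 = n := by
  have hE (k : ℕ) : iteratedDeriv k Real.exp 0 = 1 := by
    rw [iteratedDeriv_eq_iterate, Real.iter_deriv_exp, Real.exp_zero]
  have hfun : (fun v => G 1 v * (Real.exp v - 1)) = fun v => v ^ 1 * Real.exp v :=
    funext G_one_mul_exp_sub_one
  have h := congrArg (fun f => iteratedDeriv n f 0) hfun
  beta_reduce at h
  rw [iteratedDeriv_pow_mul_zero 1 n Real.contDiff_exp.contDiffAt,
    iteratedDeriv_fun_mul analyticAt_G_one.contDiffAt (by fun_prop), hE,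
    Finset.sum_range_succ, Nat.descFactorial_one, mul_one] at h
  rw [← h, Nat.sub_self, iteratedDeriv_zero, Real.exp_zero, sub_self, mul_zero, add_zero]
  refine Finset.sum_congr rfl fun i hi => ?_
  have hi' : 0 < n - i := Nat.sub_pos_of_lt (Finset.mem_range.1 hi)
  have : iteratedDeriv (n - i) (fun v => Real.exp v - 1) 0 = 1 := by
    have := iteratedDeriv_const_add (f := Real.exp) (x := 0) hi' (-1)
    simpa only [sub_eq_neg_add, hE] using this
  rw [this, mul_one]

theorem iteratedDeriv_G_one_zero (n : ℕ) : iteratedDeriv n (G 1) 0 = (bernoulli' n : ℝ) := by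
  induction n using Nat.strong_induction_on with
  | _ n ih =>
    have h₁ := sum_choose_mul_iteratedDeriv_G_one (n + 1)
    have h₂ : ∑ k ∈ Finset.range (n + 1), ((n + 1).choose k : ℝ) * (bernoulli' k : ℝ) =
        ((n + 1 : ℕ) : ℝ) := by
      exact_mod_cast congrArg (fun q : ℚ => (q : ℝ)) (sum_bernoulli' (n + 1))
    rw [Finset.sum_range_succ] at h₁ h₂
    rw [Finset.sum_congr rfl fun i hi => by rw [ih i (Finset.mem_range.1 hi)]] at h₁
    have hc : (((n + 1).choose n : ℕ) : ℝ) ≠ 0 := by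
      rw [Nat.choose_succ_self_right]
      positivity
    exact mul_left_cancel₀ hc (by linarith)

theorem iteratedDeriv_iteratedDeriv_G_zero {j k : ℕ} (hj : 1 ≤ j) (hk : 1 ≤ k) :
    iteratedDeriv (2 * k - 1) (iteratedDeriv j (G j)) 0 =
      (Nat.factorial (2 * k + j - 1) : ℝ) * (bernoulli (2 * k) : ℝ) /
        (Nat.factorial (2 * k)) := by
  have hcomp : iteratedDeriv (2 * k - 1) (iteratedDeriv j (G j)) =
      iteratedDeriv (2 * k + j - 1) (G j) := by
    simp only [iteratedDeriv_eq_iterate, ← Function.iterate_add_apply]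
    congr 2
    omega
  have hfac : (Nat.factorial (2 * k) : ℝ) * ((2 * k + j - 1).descFactorial (j - 1) : ℝ) =
      Nat.factorial (2 * k + j - 1) := by
    have := Nat.factorial_mul_descFactorial (show j - 1 ≤ 2 * k + j - 1 by omega)
    rw [show 2 * k + j - 1 - (j - 1) = 2 * k by omega] at this
    exact_mod_cast this
  rw [hcomp, G_eq_pow_mul_G_one hj, iteratedDeriv_pow_mul_zero _ _ analyticAt_G_one.contDiffAt,
    show 2 * k + j - 1 - (j - 1) = 2 * k by omega, iteratedDeriv_G_one_zero,
    bernoulli_eq_bernoulli'_of_ne_one (by omega), ← hfac]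
  field_simp

theorem hasSum_one_div_nat_pow_abs_bernoulli {k : ℕ} (hk : k ≠ 0) :
    HasSum (fun n : ℕ => 1 / (n : ℝ) ^ (2 * k))
      ((2 * Real.pi) ^ (2 * k) / 2 * (|(bernoulli (2 * k) : ℝ)| / Nat.factorial (2 * k))) := by
  have h := hasSum_zeta_nat hk
  have h0 := h.nonneg fun n => by positivity
  convert h using 1
  rw [← abs_of_nonneg h0, abs_div, abs_mul, abs_mul, abs_mul, abs_pow, abs_neg, abs_one, one_pow,
    one_mul, Nat.abs_cast, abs_of_pos (by positivity : (0 : ℝ) < 2 ^ (2 * k - 1)),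
    abs_of_pos (by positivity : (0 : ℝ) < Real.pi ^ (2 * k)), mul_pow]
  obtain ⟨m, hm⟩ : ∃ m, 2 * k = m + 1 := ⟨2 * k - 1, by omega⟩
  rw [hm, Nat.add_sub_cancel, pow_succ (2 : ℝ) m]
  ring

theorem sq_le_mul_of_hasSum {ι : Type*} {f g h : ι → ℝ} {A B C : ℝ} (hf : HasSum f A)
    (hg : HasSum g B) (hh : HasSum h C) (hf0 : ∀ i, 0 ≤ f i) (hh0 : ∀ i, 0 ≤ h i)
    (hfgh : ∀ i, g i ^ 2 = f i * h i) : B ^ 2 ≤ A * C := by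
  have key (t : ℝ) : 0 ≤ A * (t * t) + (-2 * B) * t + C := by
    have hs := ((hf.mul_right (t * t)).add ((hg.mul_left (-2)).mul_right t)).add hh
    refine hs.nonneg fun i => ?_
    rcases (hf0 i).eq_or_lt with h0 | h0
    · have : g i = 0 := by
        have := hfgh i
        rw [← h0, zero_mul] at this
        exact pow_eq_zero_iff two_ne_zero |>.1 this
      simpa [← h0, this] using hh0 i
    · refine nonneg_of_mul_nonneg_right (?_ : 0 ≤ f i * _) h0
      have e : f i * (f i * (t * t) + -2 * g i * t + h i) = (f i * t - g i) ^ 2 := by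
        linear_combination -hfgh i
      rw [e]
      positivity
  have := discrim_le_zero key
  rw [discrim] at this
  linarith

theorem abs_bernoulli_div_factorial_sq_le {k : ℕ} (hk : 1 ≤ k) :
    (|(bernoulli (2 * (k + 1)) : ℝ)| / Nat.factorial (2 * (k + 1))) ^ 2 ≤
      (|(bernoulli (2 * k) : ℝ)| / Nat.factorial (2 * k)) *
        (|(bernoulli (2 * (k + 2)) : ℝ)| / Nat.factorial (2 * (k + 2))) := by
  have h := sq_le_mul_of_hasSum
    (hasSum_one_div_nat_pow_abs_bernoulli (k := k) (by omega))
    (hasSum_one_div_nat_pow_abs_bernoulli (k := k + 1) (by omega))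
    (hasSum_one_div_nat_pow_abs_bernoulli (k := k + 2) (by omega))
    (fun n => by positivity) (fun n => by positivity) (fun n => by
      rw [div_pow, one_pow, one_div_mul_one_div, ← pow_mul, ← pow_add]
      congr 2
      ring)
  have hc : 0 < ((2 * Real.pi) ^ (2 * (k + 1)) / 2) ^ 2 := by positivity
  refine le_of_mul_le_mul_left ?_ hc
  calc _ = _ := (mul_pow _ _ 2).symm
    _ ≤ _ := h
    _ = _ := by ring

theorem factorial_succ_succ_sq_le (m : ℕ) :
    (Nat.factorial (m + 2) : ℝ) ^ 2 ≤ Nat.factorial m * Nat.factorial (m + 4) := by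
  have h : Nat.factorial (m + 2) ^ 2 ≤ Nat.factorial m * Nat.factorial (m + 4) := by
    have h₁ : Nat.factorial (m + 2) = (m + 2) * ((m + 1) * Nat.factorial m) := rfl
    have h₂ : Nat.factorial (m + 4) = (m + 4) * ((m + 3) * Nat.factorial (m + 2)) := rfl
    calc Nat.factorial (m + 2) ^ 2
        = ((m + 2) * (m + 1)) * (Nat.factorial m * Nat.factorial (m + 2)) := by
          rw [sq]; nth_rewrite 1 [h₁]; ring
      _ ≤ ((m + 4) * (m + 3)) * (Nat.factorial m * Nat.factorial (m + 2)) := by gcongr <;> omega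
      _ = _ := by rw [h₂]; ring
  exact_mod_cast h

/-- For fixed `j ≥ 1`, the sequence `a_k = |f_j^{(2k−1)}(0)| = (2k+j−1)! |B_{2k}|/(2k)!`
(`k ≥ 1`, `f_j = G_j^{(j)}`) is logarithmically convex: `a_k² ≤ a_{k−1} a_{k+1}` for
`k ≥ 2`. -/
theorem abs_f_deriv_log_convex (j : ℕ) (hj : 1 ≤ j) :
    let a : ℕ → ℝ := fun k => |iteratedDeriv (2 * k - 1) (iteratedDeriv j (G j)) 0|
    (∀ k : ℕ, 1 ≤ k →
      a k = (Nat.factorial (2 * k + j - 1) : ℝ) * |((bernoulli (2 * k) : ℚ) : ℝ)| /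
        (Nat.factorial (2 * k))) ∧
    (∀ k : ℕ, 2 ≤ k → a k ^ 2 ≤ a (k - 1) * a (k + 1)) := by
  intro a
  have ha : ∀ k : ℕ, 1 ≤ k → a k = (Nat.factorial (2 * k + j - 1) : ℝ) *
      |((bernoulli (2 * k) : ℚ) : ℝ)| / (Nat.factorial (2 * k)) := by
    intro k hk
    simp only [a]
    rw [iteratedDeriv_iteratedDeriv_G_zero hj hk, abs_div, abs_mul, Nat.abs_cast, Nat.abs_cast]
  refine ⟨ha, fun k hk => ?_⟩
  obtain ⟨k, rfl⟩ := Nat.exists_eq_add_of_le' (show 1 ≤ k by omega)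
  rw [Nat.add_sub_cancel, ha k (by omega), ha (k + 1) (by omega), ha (k + 1 + 1) (by omega)]
  have hB := abs_bernoulli_div_factorial_sq_le (k := k) (by omega)
  have hF := factorial_succ_succ_sq_le (2 * k + j - 1)
  rw [show 2 * (k + 1) + j - 1 = 2 * k + j - 1 + 2 by omega,
    show 2 * (k + 1 + 1) + j - 1 = 2 * k + j - 1 + 4 by omega,
    mul_div_assoc, mul_div_assoc, mul_div_assoc, mul_pow, mul_mul_mul_comm]
  exact mul_le_mul hF hB (by positivity) (by positivity)
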